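/- Let d > 0, θ₋, θ₊ ∈ (-1,1), and let u : [-d,d] × [0,∞) → ℝ be smooth with |u_x| < 1 and sup_{y ∈ [-d,d]} |u_x(y,0)| < 1, satisfying u_t = u_{xx}/(1 - u_x²) on [-d,d]×[0,∞) and u_x(-d,t) = θ₋, u_x(d,t) = θ₊ for all t ≥ 0. Then ∫_{-d}^{d} u_{xt}(x,t)² dx → 0 as t → ∞; i.e., for every ε > 0 there exists T > 0 such that ∫_{-d}^{d} u_{xt}(x,t)² dx ≤ ε for all t ≥ T. -/

import Mathlib

/-- First spatial partial derivative `u_x`. -/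
noncomputable def ux (u : ℝ → ℝ → ℝ) (x t : ℝ) : ℝ := deriv (fun y => u y t) x

/-- Second spatial partial derivative `u_{xx}`. -/
noncomputable def uxx (u : ℝ → ℝ → ℝ) (x t : ℝ) : ℝ := deriv (fun y => ux u y t) x

/-- Time partial derivative `u_t`. -/
noncomputable def ut (u : ℝ → ℝ → ℝ) (x t : ℝ) : ℝ := deriv (fun s => u x s) t

/-- Mixed second partial derivative `u_{xt}` (time derivative of `u_x`). -/
noncomputable def uxt (u : ℝ → ℝ → ℝ) (x t : ℝ) : ℝ := deriv (fun s => ux u x s) t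

open Set Filter Topology MeasureTheory
open scoped ContDiff

/-- The closed half-strip `[-d, d] × [0, ∞)`. -/
def strip (d : ℝ) : Set (ℝ × ℝ) := Icc (-d) d ×ˢ Ici 0

/-- Spatial derivative relative to the closed half-strip. -/
noncomputable def dX (d : ℝ) (f : ℝ × ℝ → ℝ) (p : ℝ × ℝ) : ℝ :=
  fderivWithin ℝ f (strip d) p (1, 0)

/-- Time derivative relative to the closed half-strip. -/
noncomputable def dT (d : ℝ) (f : ℝ × ℝ → ℝ) (p : ℝ × ℝ) : ℝ :=
  fderivWithin ℝ f (strip d) p (0, 1)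

section Strip

variable {d : ℝ} {f : ℝ × ℝ → ℝ}

lemma mk_mem_strip {x t : ℝ} : (x, t) ∈ strip d ↔ x ∈ Icc (-d) d ∧ 0 ≤ t := Iff.rfl

lemma uniqueDiffOn_strip (hd : 0 < d) : UniqueDiffOn ℝ (strip d) :=
  (uniqueDiffOn_Icc (by linarith)).prod (uniqueDiffOn_Ici 0)

lemma contDiffOn_dX (hd : 0 < d) (hf : ContDiffOn ℝ ∞ f (strip d)) :
    ContDiffOn ℝ ∞ (dX d f) (strip d) :=
  (hf.fderivWithin (uniqueDiffOn_strip hd) (by simp)).clm_apply contDiffOn_const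

lemma contDiffOn_dT (hd : 0 < d) (hf : ContDiffOn ℝ ∞ f (strip d)) :
    ContDiffOn ℝ ∞ (dT d f) (strip d) :=
  (hf.fderivWithin (uniqueDiffOn_strip hd) (by simp)).clm_apply contDiffOn_const

lemma hasFDerivWithinAt_strip (hf : ContDiffOn ℝ ∞ f (strip d)) {p : ℝ × ℝ} (hp : p ∈ strip d) :
    HasFDerivWithinAt f (fderivWithin ℝ f (strip d) p) (strip d) p :=
  (hf.differentiableOn (by simp) p hp).hasFDerivWithinAt

lemma hasDerivWithinAt_dX (hf : ContDiffOn ℝ ∞ f (strip d)) {x t : ℝ}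
    (hx : x ∈ Icc (-d) d) (ht : 0 ≤ t) :
    HasDerivWithinAt (fun y => f (y, t)) (dX d f (x, t)) (Icc (-d) d) x :=
  (hasFDerivWithinAt_strip hf (mk_mem_strip.2 ⟨hx, ht⟩)).comp_hasDerivWithinAt x
    ((hasDerivAt_id x).prodMk (hasDerivAt_const x t)).hasDerivWithinAt
    fun _ hy => mk_mem_strip.2 ⟨hy, ht⟩

lemma hasDerivWithinAt_dT (hf : ContDiffOn ℝ ∞ f (strip d)) {x t : ℝ}
    (hx : x ∈ Icc (-d) d) (ht : 0 ≤ t) :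
    HasDerivWithinAt (fun s => f (x, s)) (dT d f (x, t)) (Ici 0) t :=
  (hasFDerivWithinAt_strip hf (mk_mem_strip.2 ⟨hx, ht⟩)).comp_hasDerivWithinAt t
    ((hasDerivAt_const t x).prodMk (hasDerivAt_id t)).hasDerivWithinAt
    fun _ hy => mk_mem_strip.2 ⟨hx, hy⟩

lemma hasDerivAt_dX (hf : ContDiffOn ℝ ∞ f (strip d)) {x t : ℝ}
    (hx : x ∈ Ioo (-d) d) (ht : 0 ≤ t) :
    HasDerivAt (fun y => f (y, t)) (dX d f (x, t)) x :=
  (hasDerivWithinAt_dX hf (Ioo_subset_Icc_self hx) ht).hasDerivAt (Icc_mem_nhds hx.1 hx.2)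

lemma hasDerivAt_dT (hf : ContDiffOn ℝ ∞ f (strip d)) {x t : ℝ}
    (hx : x ∈ Icc (-d) d) (ht : 0 < t) :
    HasDerivAt (fun s => f (x, s)) (dT d f (x, t)) t :=
  (hasDerivWithinAt_dT hf hx ht.le).hasDerivAt (Ici_mem_nhds ht)

lemma strip_subset_closure_interior (hd : 0 < d) : strip d ⊆ closure (interior (strip d)) := by
  rw [strip, interior_prod_eq, closure_prod_eq, interior_Icc, interior_Ici, closure_Ioi,
    closure_Ioo (by linarith)]

lemma dT_dX_eq_dX_dT (hd : 0 < d) (hf : ContDiffOn ℝ ∞ f (strip d)) {p : ℝ × ℝ}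
    (hp : p ∈ strip d) : dT d (dX d f) p = dX d (dT d f) p := by
  have hu := uniqueDiffOn_strip hd p hp
  have hD : DifferentiableWithinAt ℝ (fderivWithin ℝ f (strip d)) (strip d) p :=
    (hf.fderivWithin (m := ∞) (uniqueDiffOn_strip hd) (by simp)).differentiableOn (by simp) p hp
  have hsymm : IsSymmSndFDerivWithinAt ℝ f (strip d) p :=
    (hf p hp).isSymmSndFDerivWithinAt (by simpa using ENat.LEInfty.out) (uniqueDiffOn_strip hd)
      (strip_subset_closure_interior hd hp) hp
  have key : ∀ v w : ℝ × ℝ, fderivWithin ℝ (fun q => fderivWithin ℝ f (strip d) q v) (strip d) p w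
      = fderivWithin ℝ (fderivWithin ℝ f (strip d)) (strip d) p w v := fun v w => by
    rw [fderivWithin_clm_apply hu hD (differentiableWithinAt_const v)]
    simp
  exact (key _ _).trans ((hsymm _ _).trans (key _ _).symm)

lemma ContinuousOn.slice_strip (hf : ContinuousOn f (strip d)) {t : ℝ} (ht : 0 ≤ t) :
    ContinuousOn (fun x => f (x, t)) (Icc (-d) d) :=
  hf.comp (by fun_prop) fun _ hx => mk_mem_strip.2 ⟨hx, ht⟩

lemma ContinuousOn.intervalIntegrable_strip (hd : 0 < d) (hf : ContinuousOn f (strip d)) {t : ℝ}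
    (ht : 0 ≤ t) : IntervalIntegrable (fun x => f (x, t)) volume (-d) d :=
  (hf.slice_strip ht).intervalIntegrable_of_Icc (by linarith)

lemma continuousOn_integral_strip (hd : 0 < d) (hf : ContinuousOn f (strip d)) :
    ContinuousOn (fun t => ∫ x in (-d)..d, f (x, t)) (Ici 0) := by
  have hle : -d ≤ d := by linarith
  have hc : Continuous fun q : ℝ × ℝ => f ((projIcc (-d) d hle q.2 : ℝ), max q.1 0) :=
    hf.comp_continuous (by fun_prop)
      fun q => mk_mem_strip.2 ⟨(projIcc (-d) d hle q.2).2, le_max_right _ _⟩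
  have := intervalIntegral.continuous_parametric_intervalIntegral_of_continuous'
    (f := fun t x => f ((projIcc (-d) d hle x : ℝ), max t 0)) (μ := volume) hc (-d) d
  refine this.continuousOn.congr fun t ht => intervalIntegral.integral_congr fun x hx => ?_
  rw [uIcc_of_le hle] at hx
  simp only [projIcc_of_mem hle hx, max_eq_left (mem_Ici.1 ht)]

lemma hasDerivAt_integral_strip (hd : 0 < d) {f' : ℝ × ℝ → ℝ} (hf : ContinuousOn f (strip d))
    (hf' : ContinuousOn f' (strip d))
    (hderiv : ∀ x ∈ Ioo (-d) d, ∀ t > 0, HasDerivAt (fun s => f (x, s)) (f' (x, t)) t)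
    {t : ℝ} (ht : 0 < t) :
    HasDerivAt (fun s => ∫ x in (-d)..d, f (x, s)) (∫ x in (-d)..d, f' (x, t)) t := by
  have hle : -d ≤ d := by linarith
  obtain ⟨C, hC⟩ := (isCompact_Icc.prod isCompact_Icc).exists_bound_of_continuousOn
    (hf'.mono (prod_mono (subset_refl (Icc (-d) d)) (Icc_subset_Ici_self : Icc 0 (t + 1) ⊆ Ici 0)))
  have hmem : Ioo 0 (t + 1) ∈ 𝓝 t := Ioo_mem_nhds ht (by linarith)
  refine (intervalIntegral.hasDerivAt_integral_of_dominated_loc_of_deriv_le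
    (F := fun s x => f (x, s)) (F' := fun s x => f' (x, s)) (bound := fun _ => C) hmem
    ?_ (hf.intervalIntegrable_strip hd ht.le) ?_ ?_ (by simp) ?_).2
  · filter_upwards [hmem] with s hs
    exact (hf.intervalIntegrable_strip hd hs.1.le).aestronglyMeasurable_restrict_uIoc
  · exact (hf'.intervalIntegrable_strip hd ht.le).aestronglyMeasurable_restrict_uIoc
  · refine .of_forall fun x hx s hs => hC (x, s) ⟨?_, ?_⟩
    · exact uIcc_of_le hle ▸ uIoc_subset_uIcc hx
    · exact Ioo_subset_Icc_self hs
  · filter_upwards [compl_mem_ae_iff.2 (measure_singleton (μ := volume) d)] with x hxd hx s hs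
    rw [uIoc_of_le hle] at hx
    exact hderiv x ⟨hx.1, lt_of_le_of_ne hx.2 hxd⟩ s hs.1

end Strip

lemma mul_deriv_eq_zero_of_eventually {p q : ℝ → ℝ} {p' q' θ t : ℝ} (hp : HasDerivAt p p' t)
    (hq : HasDerivAt q q' t) (h : ∀ᶠ s in 𝓝 t, p s = θ ∨ q s = 0) :
    p' = 0 ∨ (q t = 0 ∧ q' = 0) := by
  refine or_iff_not_imp_left.2 fun hp' => ?_
  have hev : q =ᶠ[𝓝[≠] t] fun _ => 0 := by
    filter_upwards [hp.eventually_ne (c := θ) hp', h.filter_mono nhdsWithin_le_nhds] with s h1 h2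
    exact h2.resolve_left h1
  have h0 : q t = 0 :=
    tendsto_nhds_unique (hq.continuousAt.continuousWithinAt.tendsto.mono_left le_rfl)
      ((tendsto_congr' hev).2 tendsto_const_nhds)
  refine ⟨h0, hq.unique ((hasDerivAt_const t (0 : ℝ)).congr_of_eventuallyEq ?_)⟩
  exact eventuallyEq_nhds_of_eventuallyEq_nhdsNE hev h0

lemma integral_mul_deriv_eq_neg {d : ℝ} (hd : 0 < d) {f g f' g' : ℝ → ℝ}
    (hf : ContinuousOn f (Icc (-d) d))
    (hg : ContinuousOn g (Icc (-d) d)) (hf' : ContinuousOn f' (Icc (-d) d))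
    (hg' : ContinuousOn g' (Icc (-d) d)) (hfd : ∀ x ∈ Ioo (-d) d, HasDerivAt f (f' x) x)
    (hgd : ∀ x ∈ Ioo (-d) d, HasDerivAt g (g' x) x)
    (hm : f (-d) * g (-d) = 0) (hp : f d * g d = 0) :
    ∫ x in (-d)..d, f x * g' x = -∫ x in (-d)..d, f' x * g x := by
  have hle : -d ≤ d := by linarith
  rw [intervalIntegral.integral_mul_deriv_eq_deriv_mul_of_hasDerivAt (u' := f') (v := g)
    (by rwa [uIcc_of_le hle]) (by rwa [uIcc_of_le hle]) (by simpa [hle] using hfd)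
    (by simpa [hle] using hgd) (hf'.intervalIntegrable_of_Icc hle)
    (hg'.intervalIntegrable_of_Icc hle), hm, hp]
  ring

/-- A nonnegative `y` with `y' ≤ C y²` that is the dissipation rate of a nonnegative energy `E`
tends to zero. -/
lemma eventually_le_of_dissipation {E y y' : ℝ → ℝ} {C : ℝ} (hC : 0 ≤ C)
    (hE : ∀ t > 0, HasDerivAt E (-(2 * y t)) t) (hy : ∀ t > 0, HasDerivAt y (y' t) t)
    (hE0 : ∀ t > 0, 0 ≤ E t) (hy0 : ∀ t > 0, 0 ≤ y t) (hle : ∀ t > 0, y' t ≤ C * y t ^ 2)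
    {ε : ℝ} (hε : 0 < ε) : ∃ T > 0, ∀ t ≥ T, y t ≤ ε := by
  have hEanti : AntitoneOn E (Ioi 0) :=
    antitoneOn_of_deriv_nonpos (convex_Ioi 0)
      (fun t ht => (hE t ht).continuousAt.continuousWithinAt)
      (fun t ht => (hE t (interior_subset ht)).differentiableAt.differentiableWithinAt)
      fun t ht => by
        rw [(hE t (interior_subset ht)).deriv]
        linarith [hy0 t (interior_subset ht)]
  have hg : ∀ t > 0, HasDerivAt (fun s => y s * Real.exp (C / 2 * E s))
      (y' t * Real.exp (C / 2 * E t) + y t * (Real.exp (C / 2 * E t) * (C / 2 * (-(2 * y t))))) t :=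
    fun t ht => (hy t ht).mul ((hE t ht).const_mul (C / 2)).exp
  have hganti : AntitoneOn (fun s => y s * Real.exp (C / 2 * E s)) (Ioi 0) :=
    antitoneOn_of_deriv_nonpos (convex_Ioi 0)
      (fun t ht => (hg t ht).continuousAt.continuousWithinAt)
      (fun t ht => (hg t (interior_subset ht)).differentiableAt.differentiableWithinAt)
      fun t ht => by
        rw [(hg t (interior_subset ht)).deriv]
        have := mul_nonneg (sub_nonneg.2 (hle t (interior_subset ht))) (Real.exp_pos (C / 2 * E t)).le
        linarith
  set K := Real.exp (C / 2 * E 1) with hK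
  have hKpos : 0 < K := Real.exp_pos _
  have hE1 : 0 ≤ E 1 := hE0 1 one_pos
  have hyK : ∀ s ≥ 1, ∀ t ≥ s, y t ≤ y s * K := fun s hs t hst => by
    have hs0 : 0 < s := by linarith
    have ht0 : 0 < t := by linarith
    calc y t ≤ y t * Real.exp (C / 2 * E t) :=
          le_mul_of_one_le_right (hy0 t ht0)
            (Real.one_le_exp (mul_nonneg (by linarith) (hE0 t ht0)))
      _ ≤ y s * Real.exp (C / 2 * E s) := hganti hs0 ht0 hst
      _ ≤ y s * K := by
          have := hEanti (mem_Ioi.2 one_pos) (mem_Ioi.2 hs0) hs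
          rw [hK]
          have := hy0 s hs0
          gcongr
  refine ⟨2 + K * E 1 / ε, by positivity, fun t ht => ?_⟩
  have h1t : 1 < t := lt_of_lt_of_le (by linarith [show 0 ≤ K * E 1 / ε by positivity]) ht
  have hpos : ∀ s ∈ Icc 1 t, 0 < s := fun s hs => by linarith [hs.1]
  have hmv := (convex_Icc 1 t).image_sub_le_mul_sub_of_deriv_le (f := E) (C := -(2 * (y t / K)))
    (fun s hs => (hE s (hpos s hs)).continuousAt.continuousWithinAt)
    (fun s hs => (hE s (hpos s (interior_subset hs))).differentiableAt.differentiableWithinAt)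
    (fun s hs => by
      have hs' := interior_subset hs
      rw [(hE s (hpos s hs')).deriv]
      have := (div_le_iff₀ hKpos).2 (hyK s hs'.1 t hs'.2)
      linarith) 1 (left_mem_Icc.2 h1t.le) t (right_mem_Icc.2 h1t.le) h1t.le
  by_contra! hlt
  have hEt := hE0 t (by linarith)
  have h2 : 2 * (y t / K) * (t - 1) ≤ E 1 := by linarith
  have h3 : K * E 1 / ε ≤ t - 1 := by linarith
  have h4 : E 1 * K ≤ ε * (t - 1) := by rw [div_le_iff₀ hε] at h3; linarith
  have h5 : 2 * y t * (t - 1) ≤ E 1 * K := by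
    have := mul_le_mul_of_nonneg_right h2 hKpos.le
    field_simp at this
    linarith
  nlinarith [mul_lt_mul_of_pos_right hlt (sub_pos.2 h1t)]

lemma hasDerivAt_max_zero_pow (n : ℕ) (s : ℝ) :
    HasDerivAt (fun r : ℝ => max r 0 ^ (n + 2)) ((n + 2) * max s 0 ^ (n + 1)) s := by
  have hne : ∀ r : ℝ, r ≠ 0 →
      HasDerivAt (fun r : ℝ => max r 0 ^ (n + 2)) ((n + 2) * max r 0 ^ (n + 1)) r := by
    intro r hr
    rcases hr.lt_or_gt with h | h
    · have : (fun r : ℝ => max r 0 ^ (n + 2)) =ᶠ[𝓝 r] fun _ => 0 := by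
        filter_upwards [Iio_mem_nhds h] with z hz
        simp [max_eq_right (le_of_lt (mem_Iio.1 hz))]
      rw [max_eq_right h.le, zero_pow n.succ_ne_zero, mul_zero]
      exact (hasDerivAt_const r (0 : ℝ)).congr_of_eventuallyEq this
    · have : (fun r : ℝ => max r 0 ^ (n + 2)) =ᶠ[𝓝 r] fun z => z ^ (n + 2) := by
        filter_upwards [Ioi_mem_nhds h] with z hz
        rw [max_eq_left (le_of_lt (mem_Ioi.1 hz))]
      rw [max_eq_left h.le]
      simpa using (hasDerivAt_pow (n + 2) r).congr_of_eventuallyEq this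
  rcases eq_or_ne s 0 with rfl | hs
  · exact hasDerivAt_of_hasDerivAt_of_ne (g := fun r : ℝ => (n + 2) * max r 0 ^ (n + 1)) hne
      (by fun_prop) (by fun_prop)
  · exact hne s hs

section Flow

variable {d θm θp m : ℝ} {U : ℝ × ℝ → ℝ}

lemma abs_dX_le_of_flow (hd : 0 < d) (hU : ContDiffOn ℝ ∞ U (strip d))
    (hpde : ∀ p ∈ strip d, dT d U p * (1 - dX d U p ^ 2) = dX d (dX d U) p)
    (hW : ∀ p ∈ strip d, |dX d U p| ≤ 1)
    (hbm : ∀ t > 0, dX d U (-d, t) = θm ∨ dT d U (-d, t) = 0)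
    (hbp : ∀ t > 0, dX d U (d, t) = θp ∨ dT d U (d, t) = 0)
    (hm : |θm| ≤ m) (hp : |θp| ≤ m) (hinit : ∀ x ∈ Icc (-d) d, |dX d U (x, 0)| ≤ m) :
    ∀ p ∈ strip d, |dX d U p| ≤ m := by
  have hle : -d ≤ d := by linarith
  have hm0 : 0 ≤ m := (abs_nonneg _).trans hm
  have hWs := contDiffOn_dX hd hU
  have hVs := contDiffOn_dT hd hU
  have hWxs := contDiffOn_dX hd hWs
  have hZs := contDiffOn_dX hd hVs
  have hWc := hWs.continuousOn
  have hVc := hVs.continuousOn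
  have hWxc := hWxs.continuousOn
  have hZc := hZs.continuousOn
  have hWt : ∀ p ∈ strip d, dT d (dX d U) p = dX d (dT d U) p :=
    fun p hp => dT_dX_eq_dX_dT hd hU hp
  set W := dX d U
  set V := dT d U
  set Z := dX d V
  have hmax_zero : ∀ w : ℝ, |w| ≤ m → max (w ^ 2 - m ^ 2) 0 = 0 := fun w hw =>
    max_eq_right (sub_nonpos.2 (sq_le_sq.2 (hw.trans (le_abs_self m))))
  have hcomp : ∀ (n : ℕ) {w : ℝ → ℝ} {w' s : ℝ}, HasDerivAt w w' s →
      HasDerivAt (fun r => max (w r ^ 2 - m ^ 2) 0 ^ (n + 2))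
        ((n + 2) * max (w s ^ 2 - m ^ 2) 0 ^ (n + 1) * (2 * w s * w')) s := by
    intro n w w' s hw
    have := (hasDerivAt_max_zero_pow n (w s ^ 2 - m ^ 2)).comp s ((hw.pow 2).sub_const (m ^ 2))
    simpa [Function.comp_def] using this
  have hFc : ContinuousOn (fun p => max (W p ^ 2 - m ^ 2) 0 ^ 3) (strip d) := by fun_prop
  have hF'c : ContinuousOn (fun p => 6 * W p * max (W p ^ 2 - m ^ 2) 0 ^ 2 * Z p) (strip d) := by
    fun_prop
  have hF : ∀ t > 0, HasDerivAt (fun s => ∫ x in (-d)..d, max (W (x, s) ^ 2 - m ^ 2) 0 ^ 3)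
      (∫ x in (-d)..d, 6 * W (x, t) * max (W (x, t) ^ 2 - m ^ 2) 0 ^ 2 * Z (x, t)) t := by
    intro t ht
    refine hasDerivAt_integral_strip hd hFc hF'c (fun x hx t ht => ?_) ht
    have hxI := Ioo_subset_Icc_self hx
    have := hcomp 1 (hasDerivAt_dT hWs hxI ht)
    rw [hWt _ (mk_mem_strip.2 ⟨hxI, ht.le⟩)] at this
    convert this using 1
    norm_num
    ring
  have hF' : ∀ t > 0,
      ∫ x in (-d)..d, 6 * W (x, t) * max (W (x, t) ^ 2 - m ^ 2) 0 ^ 2 * Z (x, t) ≤ 0 := by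
    intro t ht
    have hfc : ContinuousOn (fun p => 6 * W p * max (W p ^ 2 - m ^ 2) 0 ^ 2) (strip d) := by
      fun_prop
    have hfc' : ContinuousOn (fun p => (6 * max (W p ^ 2 - m ^ 2) 0 ^ 2
        + 24 * W p ^ 2 * max (W p ^ 2 - m ^ 2) 0) * dX d W p) (strip d) := by fun_prop
    have hfd : ∀ x ∈ Ioo (-d) d,
        HasDerivAt (fun y => 6 * W (y, t) * max (W (y, t) ^ 2 - m ^ 2) 0 ^ 2)
          ((6 * max (W (x, t) ^ 2 - m ^ 2) 0 ^ 2
            + 24 * W (x, t) ^ 2 * max (W (x, t) ^ 2 - m ^ 2) 0) * dX d W (x, t)) x := by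
      intro x hx
      have hWd := hasDerivAt_dX hWs hx ht.le
      convert! (hWd.const_mul 6).mul (hcomp 0 hWd) using 1
      norm_num
      ring
    rw [integral_mul_deriv_eq_neg hd (hfc.slice_strip ht.le) (hVc.slice_strip ht.le)
      (hfc'.slice_strip ht.le) (hZc.slice_strip ht.le) hfd
      (fun x hx => hasDerivAt_dX hVs hx ht.le)
      (by rcases hbm t ht with h | h <;> simp [h, hmax_zero _ hm])
      (by rcases hbp t ht with h | h <;> simp [h, hmax_zero _ hp])]
    refine neg_nonpos.2 (intervalIntegral.integral_nonneg hle fun x hx => ?_)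
    have hmem : (x, t) ∈ strip d := mk_mem_strip.2 ⟨hx, ht.le⟩
    have h1 : W (x, t) ^ 2 ≤ 1 := (sq_le_one_iff_abs_le_one _).2 (hW _ hmem)
    rw [← hpde _ hmem]
    have h2 := mul_nonneg (sub_nonneg.2 h1) (sq_nonneg (V (x, t)))
    have h3 : 0 ≤ max (W (x, t) ^ 2 - m ^ 2) 0 := le_max_right _ _
    calc (0 : ℝ) ≤ (6 * max (W (x, t) ^ 2 - m ^ 2) 0 ^ 2
          + 24 * W (x, t) ^ 2 * max (W (x, t) ^ 2 - m ^ 2) 0)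
            * ((1 - W (x, t) ^ 2) * V (x, t) ^ 2) := by positivity
      _ = _ := by ring
  have hanti := antitoneOn_of_deriv_nonpos (convex_Ici 0) (continuousOn_integral_strip hd hFc)
    (fun t ht => (hF t (by simpa using ht)).differentiableAt.differentiableWithinAt)
    (fun t ht => by
      have ht : 0 < t := by simpa using ht
      rw [(hF t ht).deriv]
      exact hF' t ht)
  rintro ⟨x, t⟩ ⟨hx, ht⟩
  by_contra! hlt
  have hpos : 0 < ∫ x in (-d)..d, max (W (x, t) ^ 2 - m ^ 2) 0 ^ 3 := by
    refine intervalIntegral.integral_pos (by linarith) (hFc.slice_strip ht)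
      (fun y _ => by positivity) ⟨x, hx, ?_⟩
    have : m ^ 2 < W (x, t) ^ 2 := sq_lt_sq.2 (by rwa [abs_of_nonneg hm0])
    have : 0 < max (W (x, t) ^ 2 - m ^ 2) 0 := lt_max_of_lt_left (by linarith)
    positivity
  have hzero : ∫ x in (-d)..d, max (W (x, 0) ^ 2 - m ^ 2) 0 ^ 3 = 0 := by
    rw [intervalIntegral.integral_congr (g := fun _ => 0)]
    · simp
    · intro y hy
      rw [uIcc_of_le hle] at hy
      simp [hmax_zero _ (hinit y hy)]
  have := hanti self_mem_Ici ht ht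
  simp only [hzero] at this
  linarith

lemma integral_dX_dT_sq_le_of_flow (hd : 0 < d) (hU : ContDiffOn ℝ ∞ U (strip d))
    (hpde : ∀ p ∈ strip d, dT d U p * (1 - dX d U p ^ 2) = dX d (dX d U) p)
    (hm : m < 1) (hW : ∀ p ∈ strip d, |dX d U p| ≤ m)
    (hbm : ∀ t > 0, dX d U (-d, t) = θm ∨ dT d U (-d, t) = 0)
    (hbp : ∀ t > 0, dX d U (d, t) = θp ∨ dT d U (d, t) = 0) {ε : ℝ} (hε : 0 < ε) :
    ∃ T > 0, ∀ t ≥ T, ∫ x in (-d)..d, dX d (dT d U) (x, t) ^ 2 ≤ ε := by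
  have hle : -d ≤ d := by linarith
  have hWs := contDiffOn_dX hd hU
  have hVs := contDiffOn_dT hd hU
  have hWxs := contDiffOn_dX hd hWs
  have hZs := contDiffOn_dX hd hVs
  have hVts := contDiffOn_dT hd hVs
  have hVtxs := contDiffOn_dX hd hVts
  have hWt : EqOn (dT d (dX d U)) (dX d (dT d U)) (strip d) :=
    fun p hp => dT_dX_eq_dX_dT hd hU hp
  have hWxt : ∀ p ∈ strip d, dT d (dX d (dX d U)) p = dX d (dX d (dT d U)) p := fun p hp => by
    rw [dT_dX_eq_dX_dT hd hWs hp, dX, dX, fderivWithin_congr hWt (hWt hp)]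
  have hZt : ∀ p ∈ strip d, dT d (dX d (dT d U)) p = dX d (dT d (dT d U)) p :=
    fun p hp => dT_dX_eq_dX_dT hd hVs hp
  set W := dX d U
  set V := dT d U
  set Z := dX d V
  set R := dT d V
  have hpos : ∀ p ∈ strip d, 0 < 1 - W p ^ 2 := fun p hp => by
    have := (sq_lt_one_iff_abs_lt_one _).2 ((hW p hp).trans_lt hm)
    linarith
  set A : ℝ × ℝ → ℝ := fun p => (1 - W p ^ 2)⁻¹ with hA
  have hApos : ∀ p ∈ strip d, 0 < A p := fun p hp => inv_pos.2 (hpos p hp)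
  have hAmul : ∀ p ∈ strip d, A p * (1 - W p ^ 2) = 1 := fun p hp =>
    inv_mul_cancel₀ (hpos p hp).ne'
  have hA1 : ∀ p ∈ strip d, 1 ≤ A p := fun p hp =>
    (one_le_inv₀ (hpos p hp)).2 (by linarith [sq_nonneg (W p)])
  have hAderiv : ∀ {w : ℝ → ℝ} {w' s : ℝ}, HasDerivAt w w' s → 1 - w s ^ 2 ≠ 0 →
      HasDerivAt (fun r => (1 - w r ^ 2)⁻¹) (2 * w s * w' * (1 - w s ^ 2)⁻¹ ^ 2) s := by
    intro w w' s hw hne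
    convert! ((hw.pow 2).const_sub 1).inv hne using 1
    simp [div_eq_mul_inv]
  have hWc := hWs.continuousOn
  have hVc := hVs.continuousOn
  have hZc := hZs.continuousOn
  have hRc := hVts.continuousOn
  have hRxc := hVtxs.continuousOn
  have hAc : ContinuousOn A (strip d) :=
    ContinuousOn.inv₀ (by fun_prop) fun p hp => (hpos p hp).ne'
  have hR : ∀ x ∈ Icc (-d) d, ∀ t > 0,
      R (x, t) * (1 - W (x, t) ^ 2) = 2 * W (x, t) * Z (x, t) * V (x, t) + dX d Z (x, t) := by
    intro x hx t ht
    have hmem : (x, t) ∈ strip d := mk_mem_strip.2 ⟨hx, ht.le⟩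
    have h1 := (hasDerivAt_dT hVs hx ht).mul (((hasDerivAt_dT hWs hx ht).pow 2).const_sub 1)
    have h2 := hasDerivAt_dT hWxs hx ht
    have h3 : (fun s => dX d W (x, s)) =ᶠ[𝓝 t] fun s => V (x, s) * (1 - W (x, s) ^ 2) := by
      filter_upwards [Ioi_mem_nhds ht] with s hs
      exact (hpde _ (mk_mem_strip.2 ⟨hx, le_of_lt hs⟩)).symm
    have h4 := h1.unique (h2.congr_of_eventuallyEq h3.symm)
    rw [hWxt _ hmem, hWt hmem] at h4
    norm_num at h4
    linarith
  have hQ : ∀ x ∈ Ioo (-d) d, ∀ t > 0,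
      HasDerivAt (fun y => A (y, t) * Z (y, t)) (R (x, t)) x := by
    intro x hx t ht
    have hxI := Ioo_subset_Icc_self hx
    have hmem : (x, t) ∈ strip d := mk_mem_strip.2 ⟨hxI, ht.le⟩
    convert! (hAderiv (hasDerivAt_dX hWs hx ht.le) (hpos _ hmem).ne').mul
      (hasDerivAt_dX hZs hx ht.le) using 1
    rw [← hpde _ hmem]
    change _ = 2 * W (x, t) * (V (x, t) * (1 - W (x, t) ^ 2)) * A (x, t) ^ 2 * Z (x, t)
      + A (x, t) * dX d Z (x, t)
    linear_combination (- 2 * W (x, t) * V (x, t) * A (x, t) * Z (x, t) - R (x, t)) * hAmul _ hmem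
      + A (x, t) * hR x hxI t ht
  have hb : ∀ (b θ : ℝ), b ∈ Icc (-d) d → (∀ t > 0, W (b, t) = θ ∨ V (b, t) = 0) →
      ∀ t > 0, Z (b, t) = 0 ∨ (V (b, t) = 0 ∧ R (b, t) = 0) := by
    intro b θ hbI hb t ht
    have hmem : (b, t) ∈ strip d := mk_mem_strip.2 ⟨hbI, ht.le⟩
    have := mul_deriv_eq_zero_of_eventually (hasDerivAt_dT hWs hbI ht) (hasDerivAt_dT hVs hbI ht)
      (by filter_upwards [Ioi_mem_nhds ht] with s hs using hb s hs)
    rwa [hWt hmem] at this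
  have hZm := hb (-d) θm (left_mem_Icc.2 hle) hbm
  have hZp := hb d θp (right_mem_Icc.2 hle) hbp
  have hE : ∀ t > 0, HasDerivAt (fun s => ∫ x in (-d)..d, V (x, s) ^ 2)
      (-(2 * ∫ x in (-d)..d, A (x, t) * Z (x, t) ^ 2)) t := by
    intro t ht
    have hVt := hVc.slice_strip ht.le
    have hZt := hZc.slice_strip ht.le
    have hAt := hAc.slice_strip ht.le
    have h1 := hasDerivAt_integral_strip hd (f := fun p => V p ^ 2) (f' := fun p => 2 * (V p * R p))
      (by fun_prop) (by fun_prop) (fun x hx t ht => by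
        convert! (hasDerivAt_dT hVs (Ioo_subset_Icc_self hx) ht).pow 2 using 1
        norm_num
        ring) ht
    convert h1 using 1
    rw [intervalIntegral.integral_const_mul,
      integral_mul_deriv_eq_neg hd (f := fun x => V (x, t)) (g := fun x => A (x, t) * Z (x, t)) hVt
        (hAt.mul hZt) hZt (hRc.slice_strip ht.le) (fun x hx => hasDerivAt_dX hVs hx ht.le)
        (fun x hx => hQ x hx t ht)
        (by rcases hZm t ht with h | ⟨h, -⟩ <;> simp [h])
        (by rcases hZp t ht with h | ⟨h, -⟩ <;> simp [h]), mul_neg]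
    congr 3 with x
    ring
  have hy : ∀ t > 0, HasDerivAt (fun s => ∫ x in (-d)..d, A (x, s) * Z (x, s) ^ 2)
      ((∫ x in (-d)..d, 2 * W (x, t) * A (x, t) ^ 2 * Z (x, t) ^ 3)
        - 2 * ∫ x in (-d)..d, R (x, t) ^ 2) t := by
    intro t ht
    have hRt := hRc.slice_strip ht.le
    have hZt' := hZc.slice_strip ht.le
    have hAt := hAc.slice_strip ht.le
    have h1 := hasDerivAt_integral_strip hd (f := fun p => A p * Z p ^ 2)
      (f' := fun p => 2 * W p * A p ^ 2 * Z p ^ 3 + 2 * (A p * Z p * dX d R p))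
      (by fun_prop) (by fun_prop) (fun x hx t ht => by
        have hxI := Ioo_subset_Icc_self hx
        have hmem : (x, t) ∈ strip d := mk_mem_strip.2 ⟨hxI, ht.le⟩
        convert! (hAderiv (hasDerivAt_dT hWs hxI ht) (hpos _ hmem).ne').mul
          ((hasDerivAt_dT hZs hxI ht).pow 2) using 1
        rw [hWt hmem, hZt _ hmem]
        norm_num [hA]
        ring) ht
    convert h1 using 1
    have hi1 : ContinuousOn (fun p => 2 * W p * A p ^ 2 * Z p ^ 3) (strip d) := by fun_prop
    have hi2 : ContinuousOn (fun p => 2 * (A p * Z p * dX d R p)) (strip d) := by fun_prop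
    rw [intervalIntegral.integral_add (hi1.intervalIntegrable_strip hd ht.le)
      (hi2.intervalIntegrable_strip hd ht.le), intervalIntegral.integral_const_mul 2,
      integral_mul_deriv_eq_neg hd (f := fun x => A (x, t) * Z (x, t)) (g := fun x => R (x, t))
        (hAt.mul hZt') hRt hRt (hRxc.slice_strip ht.le)
        (fun x hx => hQ x hx t ht) (fun x hx => hasDerivAt_dX hVts hx ht.le)
        (by rcases hZm t ht with h | ⟨-, h⟩ <;> simp [h])
        (by rcases hZp t ht with h | ⟨-, h⟩ <;> simp [h]), mul_neg, ← sub_eq_add_neg]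
    simp only [pow_two]
  have hzero : ∀ t > 0, ∃ x ∈ Icc (-d) d, Z (x, t) = 0 := by
    intro t ht
    rcases hZm t ht with h1 | ⟨h1, -⟩
    · exact ⟨-d, left_mem_Icc.2 hle, h1⟩
    rcases hZp t ht with h2 | ⟨h2, -⟩
    · exact ⟨d, right_mem_Icc.2 hle, h2⟩
    obtain ⟨x, hx, h⟩ := exists_hasDerivAt_eq_zero (by linarith) (hVc.slice_strip ht.le)
      (h1.trans h2.symm) fun x hx => hasDerivAt_dX hVs hx ht.le
    exact ⟨x, Ioo_subset_Icc_self hx, h⟩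
  have hQbound : ∀ t > 0, ∀ x ∈ Icc (-d) d,
      |A (x, t) * Z (x, t)| ≤ ∫ x in (-d)..d, |R (x, t)| := by
    intro t ht x hx
    obtain ⟨x₀, hx₀, h0⟩ := hzero t ht
    have hRi := hRc.intervalIntegrable_strip hd ht.le
    have hsub : uIcc x₀ x ⊆ Icc (-d) d := uIcc_subset_Icc hx₀ hx
    have hmin : -d ≤ min x₀ x := le_min hx₀.1 hx.1
    have hmax : max x₀ x ≤ d := max_le hx₀.2 hx.2
    have hftc : ∫ y in x₀..x, R (y, t) = A (x, t) * Z (x, t) - A (x₀, t) * Z (x₀, t) :=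
      intervalIntegral.integral_eq_sub_of_hasDeriv_right
        (((hAc.mul hZc).slice_strip ht.le).mono hsub)
        (fun y hy => (hQ y ⟨hmin.trans_lt hy.1, hy.2.trans_le hmax⟩ t ht).hasDerivWithinAt)
        (hRi.mono_set (by rwa [uIcc_of_le hle]))
    rw [h0, mul_zero, sub_zero] at hftc
    rw [← hftc, ← Real.norm_eq_abs]
    refine intervalIntegral.norm_integral_le_integral_norm_uIoc.trans ?_
    rw [intervalIntegral.integral_of_le hle]
    exact setIntegral_mono_set hRi.abs.1 (.of_forall fun _ => abs_nonneg _)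
      (Ioc_subset_Ioc hmin hmax).eventuallyLE
  have hy0 : ∀ t > 0, 0 ≤ ∫ x in (-d)..d, A (x, t) * Z (x, t) ^ 2 := fun t ht =>
    intervalIntegral.integral_nonneg hle fun x hx =>
      mul_nonneg (hApos _ (mk_mem_strip.2 ⟨hx, ht.le⟩)).le (sq_nonneg _)
  have hbound : ∀ t > 0, (∫ x in (-d)..d, 2 * W (x, t) * A (x, t) ^ 2 * Z (x, t) ^ 3)
        - 2 * ∫ x in (-d)..d, R (x, t) ^ 2
      ≤ d * (∫ x in (-d)..d, A (x, t) * Z (x, t) ^ 2) ^ 2 := by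
    intro t ht
    have hi1 : ContinuousOn (fun p => 2 * W p * A p ^ 2 * Z p ^ 3) (strip d) := by fun_prop
    have hi2 : ContinuousOn (fun p => A p * Z p ^ 2) (strip d) := by fun_prop
    have hi3 : ContinuousOn (fun p => |R p|) (strip d) := hRc.abs
    have hi4 : ContinuousOn (fun p => R p ^ 2) (strip d) := by fun_prop
    set N := ∫ x in (-d)..d, |R (x, t)|
    set Y := ∫ x in (-d)..d, A (x, t) * Z (x, t) ^ 2
    have h1 : ∫ x in (-d)..d, 2 * W (x, t) * A (x, t) ^ 2 * Z (x, t) ^ 3 ≤ 2 * N * Y := by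
      rw [← intervalIntegral.integral_const_mul]
      refine intervalIntegral.integral_mono_on hle (hi1.intervalIntegrable_strip hd ht.le)
        ((hi2.intervalIntegrable_strip hd ht.le).const_mul _) fun x hx => ?_
      have hmem : (x, t) ∈ strip d := mk_mem_strip.2 ⟨hx, ht.le⟩
      have hWQ : W (x, t) * (A (x, t) * Z (x, t)) ≤ N := by
        refine (le_abs_self _).trans ?_
        rw [abs_mul]
        exact (mul_le_of_le_one_left (abs_nonneg _) ((hW _ hmem).trans hm.le)).trans
          (hQbound t ht x hx)
      have := mul_le_mul_of_nonneg_right hWQ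
        (mul_nonneg (hApos _ hmem).le (sq_nonneg (Z (x, t))))
      linarith
    have h2 : 2 * Y * N ≤ 2 * (∫ x in (-d)..d, R (x, t) ^ 2) + d * Y ^ 2 := by
      have : ∫ x in (-d)..d, 2 * Y * |R (x, t)| ≤ ∫ x in (-d)..d, (2 * R (x, t) ^ 2 + Y ^ 2 / 2) := by
        refine intervalIntegral.integral_mono_on hle
          ((hi3.intervalIntegrable_strip hd ht.le).const_mul _)
          (((hi4.intervalIntegrable_strip hd ht.le).const_mul _).add (by simp)) fun x hx => ?_
        nlinarith [sq_nonneg (2 * |R (x, t)| - Y), sq_abs (R (x, t))]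
      rw [intervalIntegral.integral_add ((hi4.intervalIntegrable_strip hd ht.le).const_mul _)
        (by simp), intervalIntegral.integral_const_mul, intervalIntegral.integral_const_mul,
        intervalIntegral.integral_const, smul_eq_mul] at this
      linarith
    linarith
  obtain ⟨T, hT, h⟩ := eventually_le_of_dissipation hd.le hE hy
    (fun t _ => intervalIntegral.integral_nonneg hle fun x _ => sq_nonneg _) hy0 hbound hε
  refine ⟨T, hT, fun t ht => (intervalIntegral.integral_mono_on hle ?_ ?_ fun x hx => ?_).trans
    (h t ht)⟩
  · exact ContinuousOn.intervalIntegrable_strip (f := fun p => Z p ^ 2) hd (by fun_prop)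
      (hT.le.trans ht)
  · exact ContinuousOn.intervalIntegrable_strip (f := fun p => A p * Z p ^ 2) hd (by fun_prop)
      (hT.le.trans ht)
  · exact le_mul_of_one_le_left (sq_nonneg _) (hA1 _ (mk_mem_strip.2 ⟨hx, hT.le.trans ht⟩))

end Flow

section PartialDerivatives

variable {d : ℝ} {u : ℝ → ℝ → ℝ}

lemma ux_eq_dX (hu : ContDiffOn ℝ ∞ (fun p : ℝ × ℝ => u p.1 p.2) (strip d)) {x t : ℝ}
    (hx : x ∈ Ioo (-d) d) (ht : 0 ≤ t) : ux u x t = dX d (fun p => u p.1 p.2) (x, t) :=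
  (hasDerivAt_dX hu hx ht).deriv

lemma uxx_eq_dX_dX (hd : 0 < d) (hu : ContDiffOn ℝ ∞ (fun p : ℝ × ℝ => u p.1 p.2) (strip d))
    {x t : ℝ} (hx : x ∈ Ioo (-d) d) (ht : 0 ≤ t) :
    uxx u x t = dX d (dX d fun p => u p.1 p.2) (x, t) := by
  refine ((hasDerivAt_dX (contDiffOn_dX hd hu) hx ht).congr_of_eventuallyEq ?_).deriv
  filter_upwards [Ioo_mem_nhds hx.1 hx.2] with y hy using ux_eq_dX hu hy ht

lemma ut_eq_dT (hu : ContDiffOn ℝ ∞ (fun p : ℝ × ℝ => u p.1 p.2) (strip d)) {x t : ℝ}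
    (hx : x ∈ Icc (-d) d) (ht : 0 < t) : ut u x t = dT d (fun p => u p.1 p.2) (x, t) :=
  (hasDerivAt_dT hu hx ht).deriv

lemma uxt_eq_dX_dT (hd : 0 < d) (hu : ContDiffOn ℝ ∞ (fun p : ℝ × ℝ => u p.1 p.2) (strip d))
    {x t : ℝ} (hx : x ∈ Ioo (-d) d) (ht : 0 < t) :
    uxt u x t = dX d (dT d fun p => u p.1 p.2) (x, t) := by
  have hxI := Ioo_subset_Icc_self hx
  rw [← dT_dX_eq_dX_dT hd hu (mk_mem_strip.2 ⟨hxI, ht.le⟩)]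
  refine ((hasDerivAt_dT (contDiffOn_dX hd hu) hxI ht).congr_of_eventuallyEq ?_).deriv
  filter_upwards [Ioi_mem_nhds ht] with s hs using ux_eq_dX hu hx (le_of_lt hs)

/-- A boundary condition on the two-sided derivative `ux`, which vanishes by convention where `u`
is not differentiable, yields for the one-sided derivative a Neumann or a Dirichlet condition. -/
lemma dX_eq_or_dT_eq_zero (hd : 0 < d)
    (hu : ContDiffOn ℝ ∞ (fun p : ℝ × ℝ => u p.1 p.2) (strip d)) {b θ t : ℝ}
    (hb : b ∈ Icc (-d) d) (ht : 0 < t) (hθ : ux u b t = θ)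
    (hpde : ut u b t = uxx u b t / (1 - ux u b t ^ 2)) :
    dX d (fun p => u p.1 p.2) (b, t) = θ ∨ dT d (fun p => u p.1 p.2) (b, t) = 0 := by
  have hlt : -d < d := by linarith
  by_cases hdiff : DifferentiableAt ℝ (fun y => u y t) b
  · left
    rw [← hθ]
    exact (uniqueDiffOn_Icc hlt b hb).eq_deriv _ (hasDerivWithinAt_dX hu hb ht.le)
      hdiff.hasDerivAt.hasDerivWithinAt
  have h0 : ux u b t = 0 := deriv_zero_of_not_differentiableAt hdiff
  refine or_iff_not_imp_left.2 fun hne => ?_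
  rw [← hθ, h0] at hne
  have hndiff : ¬ DifferentiableAt ℝ (fun y => ux u y t) b := by
    intro h
    have : (𝓝[Ioo (-d) d] b).NeBot := by
      rwa [← mem_closure_iff_nhdsWithin_neBot, closure_Ioo hlt.ne]
    have h1 : Tendsto (fun y => ux u y t) (𝓝[Ioo (-d) d] b) (𝓝 (ux u b t)) :=
      h.continuousAt.continuousWithinAt
    have h2 : Tendsto (fun y => dX d (fun p => u p.1 p.2) (y, t)) (𝓝[Ioo (-d) d] b)
        (𝓝 (dX d (fun p => u p.1 p.2) (b, t))) :=
      ((contDiffOn_dX hd hu).continuousOn.slice_strip ht.le b hb).mono Ioo_subset_Icc_self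
    refine hne ((tendsto_nhds_unique (h1.congr' ?_) h2).symm.trans h0)
    filter_upwards [self_mem_nhdsWithin] with y hy using ux_eq_dX hu hy ht.le
  rw [← ut_eq_dT hu hb ht, hpde, uxx, deriv_zero_of_not_differentiableAt hndiff, zero_div]

end PartialDerivatives

theorem stmt_6 (d θm θp : ℝ) (hd : 0 < d)
    (hθm : θm ∈ Set.Ioo (-1 : ℝ) 1) (hθp : θp ∈ Set.Ioo (-1 : ℝ) 1)
    (u : ℝ → ℝ → ℝ)
    (hsmooth : ContDiffOn ℝ (⊤ : ℕ∞) (fun p : ℝ × ℝ => u p.1 p.2) (Set.Icc (-d) d ×ˢ Set.Ici 0))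
    (hspace : ∀ x ∈ Set.Icc (-d) d, ∀ t ≥ (0 : ℝ), |ux u x t| < 1)
    (hinit : sSup ((fun y => |ux u y 0|) '' Set.Icc (-d) d) < 1)
    (hpde : ∀ x ∈ Set.Icc (-d) d, ∀ t ≥ (0 : ℝ),
      ut u x t = uxx u x t / (1 - (ux u x t) ^ 2))
    (hbcm : ∀ t ≥ (0 : ℝ), ux u (-d) t = θm)
    (hbcp : ∀ t ≥ (0 : ℝ), ux u d t = θp) :
    ∀ ε > (0 : ℝ), ∃ T > (0 : ℝ), ∀ t ≥ T,
      (∫ x in (-d)..d, (uxt u x t) ^ 2) ≤ ε := by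
  intro ε hε
  have hlt : -d < d := by linarith
  have hU : ContDiffOn ℝ ∞ (fun p : ℝ × ℝ => u p.1 p.2) (strip d) := hsmooth
  have hWs := contDiffOn_dX hd hU
  have hWc := hWs.continuousOn
  have hWxc := (contDiffOn_dX hd hWs).continuousOn
  have hVc := (contDiffOn_dT hd hU).continuousOn
  have hint : interior (strip d) = Ioo (-d) d ×ˢ Ioi 0 := by
    rw [strip, interior_prod_eq, interior_Icc, interior_Ici]
  have hbm : ∀ t > 0, dX d (fun p => u p.1 p.2) (-d, t) = θm
      ∨ dT d (fun p => u p.1 p.2) (-d, t) = 0 := fun t ht =>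
    dX_eq_or_dT_eq_zero hd hU (left_mem_Icc.2 hlt.le) ht (hbcm t ht.le)
      (hpde _ (left_mem_Icc.2 hlt.le) t ht.le)
  have hbp : ∀ t > 0, dX d (fun p => u p.1 p.2) (d, t) = θp
      ∨ dT d (fun p => u p.1 p.2) (d, t) = 0 := fun t ht =>
    dX_eq_or_dT_eq_zero hd hU (right_mem_Icc.2 hlt.le) ht (hbcp t ht.le)
      (hpde _ (right_mem_Icc.2 hlt.le) t ht.le)
  have huxt : ∀ t > 0, ∫ x in (-d)..d, uxt u x t ^ 2
      = ∫ x in (-d)..d, dX d (dT d fun p => u p.1 p.2) (x, t) ^ 2 := fun t ht => by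
    refine intervalIntegral.integral_congr_ae ?_
    filter_upwards [compl_mem_ae_iff.2 (measure_singleton (μ := volume) d)] with x hxd hx
    rw [uIoc_of_le hlt.le] at hx
    rw [uxt_eq_dX_dT hd hU ⟨hx.1, lt_of_le_of_ne hx.2 hxd⟩ ht]
  have hux := @ux_eq_dX d u hU
  have huxx := @uxx_eq_dX_dX d u hd hU
  have hut := @ut_eq_dT d u hU
  set U : ℝ × ℝ → ℝ := fun p => u p.1 p.2
  have hpde' : ∀ p ∈ strip d, dT d U p * (1 - dX d U p ^ 2) = dX d (dX d U) p := by
    refine Set.EqOn.of_subset_closure (s := interior (strip d)) ?_ (by fun_prop) hWxc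
      interior_subset (strip_subset_closure_interior hd)
    rintro ⟨x, t⟩ hp
    obtain ⟨hx, ht⟩ : x ∈ Ioo (-d) d ∧ 0 < t := by simpa [hint] using hp
    have hxI := Ioo_subset_Icc_self hx
    have h1 := (sq_lt_one_iff_abs_lt_one _).2 (hspace x hxI t ht.le)
    have h2 := hpde x hxI t ht.le
    rw [eq_div_iff (by linarith)] at h2
    simpa only [hux hx ht.le, huxx hx ht.le, hut hxI ht] using h2
  have hW : ∀ p ∈ strip d, |dX d U p| ≤ 1 := by
    have : EqOn (fun p => min |dX d U p| 1) (fun p => |dX d U p|) (strip d) := by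
      refine Set.EqOn.of_subset_closure (s := interior (strip d)) ?_
        (by fun_prop) hWc.abs interior_subset
        (strip_subset_closure_interior hd)
      rintro ⟨x, t⟩ hp
      obtain ⟨hx, ht⟩ : x ∈ Ioo (-d) d ∧ 0 < t := by simpa [hint] using hp
      have := hspace x (Ioo_subset_Icc_self hx) t ht.le
      rw [hux hx ht.le] at this
      exact min_eq_left this.le
    exact fun p hp => min_eq_left_iff.1 (this hp)
  set M := sSup ((fun y => |ux u y 0|) '' Icc (-d) d)
  have hM : ∀ x ∈ Icc (-d) d, |dX d U (x, 0)| ≤ M := by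
    have hc := (hWc.slice_strip le_rfl).abs
    have : EqOn (fun x => min |dX d U (x, 0)| M) (fun x => |dX d U (x, 0)|) (Icc (-d) d) := by
      refine Set.EqOn.of_subset_closure (s := Ioo (-d) d) (fun x hx => ?_)
        (by fun_prop) hc Ioo_subset_Icc_self (closure_Ioo hlt.ne).ge
      have hbdd : BddAbove ((fun y => |ux u y 0|) '' Icc (-d) d) :=
        ⟨1, by rintro _ ⟨y, hy, rfl⟩; exact (hspace y hy 0 le_rfl).le⟩
      have := le_csSup hbdd (mem_image_of_mem _ (Ioo_subset_Icc_self hx))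
      rw [hux hx le_rfl] at this
      exact min_eq_left this
    exact fun x hx => min_eq_left_iff.1 (this hx)
  obtain ⟨T, hT, h⟩ := integral_dX_dT_sq_le_of_flow (m := max (max |θm| |θp|) M) hd hU hpde'
    (max_lt (max_lt (abs_lt.2 hθm) (abs_lt.2 hθp)) hinit)
    (abs_dX_le_of_flow hd hU hpde' hW hbm hbp ((le_max_left _ _).trans (le_max_left _ _))
      ((le_max_right _ _).trans (le_max_left _ _)) fun x hx => (hM x hx).trans (le_max_right _ _))
    hbm hbp hε
  exact ⟨T, hT, fun t ht => (huxt t (hT.trans_le ht)).trans_le (h t ht)⟩
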